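/- Fix positive integers m, z and a real τ ≥ 2. Let F ⊆ 2^{[n]} be an upward closed family with μ_p(F) ≥ τ^{−z}, where p ∈ (0, (2^6 τ)^{−m}/2). Then there exists a set R ⊆ [n] of size at most 4z such that, for p̃ = (2^6 τ)^m · p, one has μ_{p̃}^{−R}(F(R)) ≥ (μ_p(F))^{(3/4)^m}, and F(R) is τ-global with respect to the measure μ_{p̃}^{−R} on subsets of [n] \ R. -/

import Mathlib

open Finset
open scoped Classical

variable {γ : Type*}

/-- `F(B) = {F \ B : F ∈ F, B ⊆ F}`. -/
def famRestrict [DecidableEq γ] (F : Finset (Finset γ)) (B : Finset γ) : Finset (Finset γ) :=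
  (F.filter fun A => B ⊆ A).image fun A => A \ B

/-- `F[ℬ] = {F ∈ F : ∃ B ∈ ℬ, B ⊆ F}`. -/
def famAbove [DecidableEq γ] (F ℬ : Finset (Finset γ)) : Finset (Finset γ) :=
  F.filter fun A => ∃ B ∈ ℬ, B ⊆ A

/-- The shadow `∂_h F`. -/
def famShadow [DecidableEq γ] (F : Finset (Finset γ)) (h : ℕ) : Finset (Finset γ) :=
  F.biUnion fun A => Finset.powersetCard h A

/-- The shadow `∂_{≤h} F`. -/
def famShadowLe [DecidableEq γ] (F : Finset (Finset γ)) (h : ℕ) : Finset (Finset γ) :=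
  (Finset.range (h + 1)).biUnion fun j => famShadow F j

/-- `P` is a sunflower with `s` petals and core `K`: `P` consists of `s` sets, `K` is
the intersection of all members of `P`, and any two distinct members intersect in `K`. -/
def IsSunflower [DecidableEq γ] (P : Finset (Finset γ)) (s : ℕ) (K : Finset γ) : Prop :=
  P.card = s ∧ ∃ hP : P.Nonempty, K = P.inf' hP id ∧
    ∀ A ∈ P, ∀ B ∈ P, A ≠ B → A ∩ B = K

/-- `F` contains no sunflower with `s` petals (with arbitrary core). -/
def SunflowerFree [DecidableEq γ] (F : Finset (Finset γ)) (s : ℕ) : Prop :=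
  ∀ P ⊆ F, ∀ K : Finset γ, ¬ IsSunflower P s K

/-- `φ(s,t)`: the maximal size of a family of `t`-element sets with no sunflower
with `s` petals. -/
noncomputable def phi (s t : ℕ) : ℕ :=
  sSup {m : ℕ | ∃ F : Finset (Finset ℕ),
    (∀ A ∈ F, A.card = t) ∧ SunflowerFree F s ∧ F.card = m}

/-- `G` is `R`-spread: `|G(X)| ≤ R^{-|X|} |G|` for every `X`. -/
def IsSpread [DecidableEq γ] (R : ℝ) (G : Finset (Finset γ)) : Prop :=
  ∀ X : Finset γ, ((famRestrict G X).card : ℝ) ≤ R ^ (-(X.card : ℤ)) * G.card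

/-- `F` is `k`-uniform. -/
def IsUniform (F : Finset (Finset γ)) (k : ℕ) : Prop := ∀ A ∈ F, A.card = k

/-- `𝒜` is `(r,t)`-spread: `𝒜(T)` is `r`-spread for every `T ∈ ∂_{≤t} 𝒜`. -/
def IsRTSpread [DecidableEq γ] (𝒜 : Finset (Finset γ)) (r : ℝ) (t : ℕ) : Prop :=
  ∀ T ∈ famShadowLe 𝒜 t, IsSpread r (famRestrict 𝒜 T)

/-- `F` is `τ`-homogeneous with respect to `𝒜`:
`|F(X)| ⬝ |𝒜| ≤ τ^{|X|} ⬝ |F| ⬝ |𝒜(X)|` for every `X`. -/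
def IsHomog [DecidableEq γ] (τ : ℝ) (F 𝒜 : Finset (Finset γ)) : Prop :=
  ∀ X : Finset γ,
    ((famRestrict F X).card : ℝ) * 𝒜.card ≤ τ ^ X.card * F.card * (famRestrict 𝒜 X).card

/-- The `p`-biased weight of a family `F` on a ground set of size `m`:
`μ_p(F) = Σ_{A ∈ F} p^{|A|} (1-p)^{m-|A|}`. -/
noncomputable def muB (m : ℕ) (p : ℝ) (F : Finset (Finset ℕ)) : ℝ :=
  ∑ A ∈ F, p ^ A.card * (1 - p) ^ (m - A.card)

/-- `F(A, B) = {F \ B : F ∈ F, F ∩ B = A}`. -/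
def famRestrict2 (F : Finset (Finset ℕ)) (A B : Finset ℕ) : Finset (Finset ℕ) :=
  (F.filter fun S => S ∩ B = A).image fun S => S \ B

/-- `F` is `τ`-global with respect to the `p`-biased measure on subsets of the ground
set `W`: for all `A ⊆ B ⊆ W`, `μ_p^{-B}(F(A,B)) ≤ τ^{|B|} μ_p(F)`. -/
noncomputable def IsGlobalOn (W : Finset ℕ) (p τ : ℝ) (F : Finset (Finset ℕ)) : Prop :=
  ∀ A B : Finset ℕ, A ⊆ B → B ⊆ W →
    muB (W.card - B.card) p (famRestrict2 F A B) ≤ τ ^ B.card * muB W.card p F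

/-- The expectation of `f` over a `p`-biased random subset of `W`. -/
noncomputable def biasedExp {H : Type*} [AddCommGroup H] [Module ℝ H] (W : Finset ℕ) (p : ℝ)
    (f : Finset ℕ → H) : H :=
  ∑ A ∈ W.powerset, (p ^ A.card * (1 - p) ^ (W.card - A.card)) • f A

section BiasedExp

variable {H : Type*} [AddCommGroup H] [Module ℝ H]

theorem biasedExp_empty (p : ℝ) (f : Finset ℕ → H) : biasedExp ∅ p f = f ∅ := by
  simp [biasedExp]

theorem biasedExp_insert {W : Finset ℕ} {a : ℕ} (ha : a ∉ W) (p : ℝ) (f : Finset ℕ → H) :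
    biasedExp (insert a W) p f =
      biasedExp W p fun A => (1 - p) • f A + p • f (insert a A) := by
  unfold biasedExp
  rw [Finset.sum_powerset_insert ha, ← Finset.sum_add_distrib]
  refine Finset.sum_congr rfl fun A hA => ?_
  have hAW := Finset.mem_powerset.1 hA
  have hle := Finset.card_le_card hAW
  rw [Finset.card_insert_of_notMem ha, Finset.card_insert_of_notMem fun h => ha (hAW h),
    smul_add, smul_smul, smul_smul]
  congr 2
  · rw [Nat.sub_add_comm hle]; ring
  · rw [Nat.add_sub_add_right]; ring

theorem biasedExp_add (W : Finset ℕ) (p : ℝ) (f g : Finset ℕ → H) :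
    biasedExp W p (fun A => f A + g A) = biasedExp W p f + biasedExp W p g := by
  simp [biasedExp, Finset.sum_add_distrib]

theorem biasedExp_smul (W : Finset ℕ) (p c : ℝ) (f : Finset ℕ → H) :
    biasedExp W p (fun A => c • f A) = c • biasedExp W p f := by
  simp only [biasedExp, Finset.smul_sum]
  exact Finset.sum_congr rfl fun A _ => smul_comm _ _ _

theorem biasedExp_mul (W : Finset ℕ) (p c : ℝ) (f : Finset ℕ → ℝ) :
    biasedExp W p (fun A => c * f A) = c * biasedExp W p f :=
  biasedExp_smul W p c f

theorem biasedExp_congr {W : Finset ℕ} {p : ℝ} {f g : Finset ℕ → H}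
    (h : ∀ A ⊆ W, f A = g A) : biasedExp W p f = biasedExp W p g :=
  Finset.sum_congr rfl fun A hA => by rw [h A (Finset.mem_powerset.1 hA)]

theorem biasedExp_mono {W : Finset ℕ} {p : ℝ} (hp0 : 0 ≤ p) (hp1 : p ≤ 1)
    {f g : Finset ℕ → ℝ} (h : ∀ A ⊆ W, f A ≤ g A) : biasedExp W p f ≤ biasedExp W p g := by
  have : 0 ≤ 1 - p := by linarith
  exact Finset.sum_le_sum fun A hA =>
    mul_le_mul_of_nonneg_left (h A (Finset.mem_powerset.1 hA)) (by positivity)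

theorem biasedExp_const (W : Finset ℕ) (p c : ℝ) : biasedExp W p (fun _ => c) = c := by
  induction W using Finset.induction_on with
  | empty => simp [biasedExp_empty]
  | insert a W ha ih =>
    rw [biasedExp_insert ha]
    simpa [← add_mul] using ih

/-- A `q`-biased random set followed by an `ε`-biased random subset of it is `ε * q`-biased. -/
theorem biasedExp_biasedExp (W : Finset ℕ) (ε q : ℝ) (f : Finset ℕ → H) :
    biasedExp W q (fun x => biasedExp x ε f) = biasedExp W (ε * q) f := by
  induction W using Finset.induction_on generalizing f with
  | empty => simp [biasedExp_empty]
  | insert a W ha ih =>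
    rw [biasedExp_insert ha, biasedExp_insert ha, ← ih]
    refine biasedExp_congr fun x hx => ?_
    rw [biasedExp_insert fun h => ha (hx h)]
    simp only [biasedExp_add, biasedExp_smul]
    module

theorem sq_biasedExp_mul_le {W : Finset ℕ} {p : ℝ} (hp0 : 0 ≤ p) (hp1 : p ≤ 1)
    (f g : Finset ℕ → ℝ) :
    biasedExp W p (fun A => f A * g A) ^ 2 ≤
      biasedExp W p (fun A => f A ^ 2) * biasedExp W p (fun A => g A ^ 2) := by
  have : 0 ≤ 1 - p := by linarith
  simp only [biasedExp, smul_eq_mul]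
  exact Finset.sum_sq_le_sum_mul_sum_of_sq_le_mul _ (fun A _ => by positivity)
    (fun A _ => by positivity) fun A _ => (by ring : _ = _).le

end BiasedExp

/-- Every restriction of `f` fixing the coordinates in `B ⊆ W` has second moment at most
`τ ^ |B| * M`. -/
def HasGlobalSecondMoment {H : Type*} [NormedAddCommGroup H] (W : Finset ℕ) (p τ M : ℝ)
    (f : Finset ℕ → H) : Prop :=
  ∀ B ⊆ W, ∀ A ⊆ B, biasedExp (W \ B) p (fun C => ‖f (C ∪ A)‖ ^ 2) ≤ τ ^ B.card * M

section Hypercontractivity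

variable {H : Type*} [NormedAddCommGroup H] [InnerProductSpace ℝ H]

theorem norm_four_two_point (u w : H) {ε q : ℝ} (hq0 : 0 ≤ q) (hq1 : q ≤ 1) :
    (1 - q) * ‖u - (ε * q) • w‖ ^ 4 + q * ‖u + (ε - ε * q) • w‖ ^ 4 ≤
      (‖u‖ ^ 2 + 4 * ε * (ε * q) * ‖w‖ ^ 2) ^ 2 + 3 * ε ^ 3 * (ε * q) * ‖w‖ ^ 4 := by
  have h1 : ‖u - (ε * q) • w‖ ^ 2 =
      ‖u‖ ^ 2 - 2 * (ε * q) * inner ℝ u w + (ε * q) ^ 2 * ‖w‖ ^ 2 := by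
    rw [norm_sub_sq_real, inner_smul_right, norm_smul, mul_pow, Real.norm_eq_abs, sq_abs]; ring
  have h2 : ‖u + (ε - ε * q) • w‖ ^ 2 =
      ‖u‖ ^ 2 + 2 * (ε - ε * q) * inner ℝ u w + (ε - ε * q) ^ 2 * ‖w‖ ^ 2 := by
    rw [norm_add_sq_real, inner_smul_right, norm_smul, mul_pow, Real.norm_eq_abs, sq_abs]; ring
  have hs : (inner ℝ u w : ℝ) ^ 2 ≤ ‖u‖ ^ 2 * ‖w‖ ^ 2 := by
    rw [← mul_pow, ← sq_abs]
    exact pow_le_pow_left₀ (abs_nonneg _) (abs_real_inner_le_norm u w) 2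
  have e1 : ‖u - (ε * q) • w‖ ^ 4 = (‖u - (ε * q) • w‖ ^ 2) ^ 2 := by ring
  have e2 : ‖u + (ε - ε * q) • w‖ ^ 4 = (‖u + (ε - ε * q) • w‖ ^ 2) ^ 2 := by ring
  have e3 : ‖w‖ ^ 4 = (‖w‖ ^ 2) ^ 2 := by ring
  rw [e1, e2, e3, h1, h2]
  have ha : 0 ≤ ‖u‖ ^ 2 := by positivity
  have hb : 0 ≤ ‖w‖ ^ 2 := by positivity
  generalize ‖u‖ ^ 2 = a at *
  generalize ‖w‖ ^ 2 = b at *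
  generalize (inner ℝ u w : ℝ) = s at *
  have hr : 0 ≤ 1 - q := by linarith
  have hk : 0 ≤ ε ^ 2 * q * (1 - q) := by positivity
  have hcube : 2 * ((1 - 2 * q) * (s * (ε * b))) ≤ s ^ 2 + (ε * b) ^ 2 := by
    have h3 := mul_nonneg hr (sq_nonneg (s - ε * b))
    have h4 := mul_nonneg hq0 (sq_nonneg (s + ε * b))
    nlinarith
  have hquart : (1 - 3 * q + 3 * q ^ 2) * (ε * b) ^ 2 ≤ (ε * b) ^ 2 := by
    nlinarith [mul_nonneg (mul_nonneg hq0 hr) (sq_nonneg (ε * b))]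
  have key : ε ^ 2 * q * (1 - q) * (4 * s ^ 2 + 2 * (a * b)
      + 4 * ((1 - 2 * q) * (s * (ε * b))) + (1 - 3 * q + 3 * q ^ 2) * (ε * b) ^ 2) ≤
      ε ^ 2 * q * (1 - q) * (8 * (a * b) + 3 * (ε * b) ^ 2) :=
    mul_le_mul_of_nonneg_left (by linarith) hk
  have hdrop : ε ^ 2 * q * (1 - q) * (8 * (a * b) + 3 * (ε * b) ^ 2) ≤
      ε ^ 2 * q * (8 * (a * b) + 3 * (ε * b) ^ 2) := by
    have : 0 ≤ ε ^ 2 * q * q * (8 * (a * b) + 3 * (ε * b) ^ 2) := by positivity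
    nlinarith
  have hlast : 0 ≤ (4 * ε * (ε * q) * b) ^ 2 := by positivity
  calc _ = a ^ 2 + ε ^ 2 * q * (1 - q) * (4 * s ^ 2 + 2 * (a * b)
      + 4 * ((1 - 2 * q) * (s * (ε * b))) + (1 - 3 * q + 3 * q ^ 2) * (ε * b) ^ 2) := by ring
    _ ≤ a ^ 2 + ε ^ 2 * q * (8 * (a * b) + 3 * (ε * b) ^ 2) := by linarith
    _ ≤ a ^ 2 + ε ^ 2 * q * (8 * (a * b) + 3 * (ε * b) ^ 2) + (4 * ε * (ε * q) * b) ^ 2 := by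
      linarith
    _ = _ := by ring

theorem sq_norm_two_point (v₀ v₁ : H) (p : ℝ) :
    (1 - p) * ‖v₀‖ ^ 2 + p * ‖v₁‖ ^ 2 =
      ‖(1 - p) • v₀ + p • v₁‖ ^ 2 + p * (1 - p) * ‖v₁ - v₀‖ ^ 2 := by
  rw [norm_add_sq_real, norm_sub_sq_real, inner_smul_left, inner_smul_right, norm_smul,
    norm_smul, mul_pow, mul_pow, Real.norm_eq_abs, Real.norm_eq_abs, sq_abs, sq_abs,
    real_inner_comm v₀ v₁]
  simp only [conj_trivial]
  ring

theorem biasedExp_toLp {K : Type*} [NormedAddCommGroup K] [InnerProductSpace ℝ K]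
    (x : Finset ℕ) (p : ℝ) (u : Finset ℕ → H) (w : Finset ℕ → K) :
    biasedExp x p (fun C => WithLp.toLp 2 (u C, w C)) =
      WithLp.toLp 2 (biasedExp x p u, biasedExp x p w) := by
  unfold biasedExp
  apply (WithLp.linearEquiv 2 ℝ (H × K)).injective
  simp only [map_sum, map_smul]
  ext <;> simp [Prod.fst_sum, Prod.snd_sum]

theorem HasGlobalSecondMoment.difference {W : Finset ℕ} {a : ℕ} (ha : a ∉ W) {p τ M : ℝ}
    (hp0 : 0 ≤ p) (hp1 : p ≤ 1) {f : Finset ℕ → H}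
    (hf : HasGlobalSecondMoment (insert a W) p τ M f) :
    HasGlobalSecondMoment W p τ (4 * τ * M) fun C => f (insert a C) - f C := by
  intro B hB A hA
  have haB : a ∉ B := fun h => ha (hB h)
  have hsd : insert a W \ insert a B = W \ B := by
    ext x; simp only [mem_sdiff, mem_insert]; grind
  have h1 := hf (insert a B) (insert_subset_insert a hB) (insert a A) (insert_subset_insert a hA)
  have h2 := hf (insert a B) (insert_subset_insert a hB) A (hA.trans (subset_insert a B))
  rw [hsd, card_insert_of_notMem haB] at h1 h2
  simp only [union_insert] at h1
  calc _ ≤ biasedExp (W \ B) p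
        (fun C => 2 * ‖f (insert a (C ∪ A))‖ ^ 2 + 2 * ‖f (C ∪ A)‖ ^ 2) :=
        biasedExp_mono hp0 hp1 fun C _ => by
          have := parallelogram_law_with_norm ℝ (f (insert a (C ∪ A))) (f (C ∪ A))
          nlinarith [sq_nonneg ‖f (insert a (C ∪ A)) + f (C ∪ A)‖]
    _ ≤ τ ^ B.card * (4 * τ * M) := by
      rw [biasedExp_add, biasedExp_mul, biasedExp_mul]
      rw [pow_succ] at h1 h2
      linarith

theorem HasGlobalSecondMoment.average_difference {W : Finset ℕ} {a : ℕ} (ha : a ∉ W)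
    {p τ M c : ℝ} (hp0 : 0 ≤ p) (hp1 : p ≤ 1) (hc : c ^ 2 ≤ p * (1 - p)) {f : Finset ℕ → H}
    (hf : HasGlobalSecondMoment (insert a W) p τ M f) :
    HasGlobalSecondMoment W p τ M fun C =>
      WithLp.toLp 2 ((1 - p) • f C + p • f (insert a C), c • (f (insert a C) - f C)) := by
  intro B hB A hA
  refine le_trans ?_ (hf B (hB.trans (subset_insert a W)) A hA)
  rw [insert_sdiff_of_notMem _ fun h => ha (hB h),
    biasedExp_insert fun h => ha (mem_sdiff.1 h).1]
  refine biasedExp_mono hp0 hp1 fun C _ => ?_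
  simp only [insert_union, smul_eq_mul]
  rw [sq_norm_two_point, WithLp.prod_norm_sq_eq_of_L2]
  simp only [WithLp.toLp_fst, WithLp.toLp_snd, norm_smul, mul_pow, Real.norm_eq_abs, sq_abs]
  gcongr

end Hypercontractivity

/-- Hypercontractivity for global functions: passing from an `ε * q`-biased to a `q`-biased
random set, the averaged function has fourth moment controlled by second moments. -/
theorem HasGlobalSecondMoment.fourth_moment_le {ε q τ : ℝ} (hε : 0 ≤ ε) (hq0 : 0 ≤ q)
    (hq1 : q ≤ 1) (hε1 : ε ≤ 1) (hsmall : 4 * ε + 12 * ε ^ 3 * τ ≤ 1 - ε * q)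
    (hτ : 0 ≤ τ) (W : Finset ℕ) {H : Type} [NormedAddCommGroup H] [InnerProductSpace ℝ H]
    {f : Finset ℕ → H} {M : ℝ} (hM : 0 ≤ M)
    (hf : HasGlobalSecondMoment W (ε * q) τ M f) :
    biasedExp W q (fun x => ‖biasedExp x ε f‖ ^ 4) ≤
      M * biasedExp W (ε * q) (fun A => ‖f A‖ ^ 2) := by
  have hp0 : 0 ≤ ε * q := by positivity
  have hp1 : ε * q ≤ 1 := mul_le_one₀ hε1 hq0 hq1
  induction W using Finset.induction_on generalizing H f M with
  | empty =>
    have h := hf ∅ (Subset.refl _) ∅ (Subset.refl _)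
    simp only [sdiff_self, bot_eq_empty, biasedExp_empty, card_empty, pow_zero, one_mul,
      union_empty] at h ⊢
    nlinarith [sq_nonneg ‖f ∅‖]
  | insert a W ha ih =>
    set p := ε * q with hp
    set u : Finset ℕ → H := fun C => (1 - p) • f C + p • f (insert a C) with hu
    set w : Finset ℕ → H := fun C => f (insert a C) - f C with hw
    have hc : √(4 * ε * p) ^ 2 = 4 * ε * p := Real.sq_sqrt (by positivity)
    have hc' : √(4 * ε * p) ^ 2 ≤ p * (1 - p) := by
      have : 0 ≤ 12 * ε ^ 3 * τ := by positivity
      rw [hc]; nlinarith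
    have ih₁ := ih hM (hf.average_difference ha hp0 hp1 hc')
    have ih₂ := ih (by positivity) (hf.difference ha hp0 hp1)
    rw [biasedExp_insert ha, biasedExp_insert ha]
    have hpoint : ∀ x ⊆ W, (1 - q) • ‖biasedExp x ε f‖ ^ 4 + q • ‖biasedExp (insert a x) ε f‖ ^ 4
        ≤ ‖biasedExp x ε (fun C => WithLp.toLp 2 (u C, √(4 * ε * p) • w C))‖ ^ 4
          + 3 * ε ^ 3 * p * ‖biasedExp x ε w‖ ^ 4 := by
      intro x hx
      have h0 : biasedExp x ε f = biasedExp x ε u - p • biasedExp x ε w := by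
        rw [sub_eq_add_neg, ← neg_smul, ← biasedExp_smul, ← biasedExp_add]
        exact biasedExp_congr fun C _ => by simp only [hu, hw]; module
      have h1 : biasedExp (insert a x) ε f = biasedExp x ε u + (ε - p) • biasedExp x ε w := by
        rw [biasedExp_insert fun h => ha (hx h), ← biasedExp_smul, ← biasedExp_add]
        exact biasedExp_congr fun C _ => by simp only [hu, hw]; module
      have h2 : ‖biasedExp x ε (fun C => WithLp.toLp 2 (u C, √(4 * ε * p) • w C))‖ ^ 4 =
          (‖biasedExp x ε u‖ ^ 2 + 4 * ε * p * ‖biasedExp x ε w‖ ^ 2) ^ 2 := by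
        rw [biasedExp_toLp, biasedExp_smul, show 4 = 2 * 2 from rfl, pow_mul,
          WithLp.prod_norm_sq_eq_of_L2]
        simp only [WithLp.toLp_fst, WithLp.toLp_snd, norm_smul, mul_pow, Real.norm_eq_abs, sq_abs, hc]
      rw [h0, h1, h2]
      exact norm_four_two_point _ _ hq0 hq1
    refine (biasedExp_mono hq0 hq1 hpoint).trans ?_
    rw [biasedExp_add, biasedExp_mul]
    have hcoef : 0 ≤ 3 * ε ^ 3 * p := by positivity
    refine (add_le_add ih₁ (mul_le_mul_of_nonneg_left ih₂ hcoef)).trans ?_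
    have e1 : biasedExp W p (fun A => ‖WithLp.toLp 2 (u A, √(4 * ε * p) • w A)‖ ^ 2) =
        biasedExp W p (fun A => ‖u A‖ ^ 2) + 4 * ε * p * biasedExp W p (fun A => ‖w A‖ ^ 2) := by
      rw [← biasedExp_mul, ← biasedExp_add]
      refine biasedExp_congr fun A _ => ?_
      rw [WithLp.prod_norm_sq_eq_of_L2]
      simp only [WithLp.toLp_fst, WithLp.toLp_snd, norm_smul, mul_pow, Real.norm_eq_abs, sq_abs, hc]
    have e2 : biasedExp W p (fun A => (1 - p) • ‖f A‖ ^ 2 + p • ‖f (insert a A)‖ ^ 2) =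
        biasedExp W p (fun A => ‖u A‖ ^ 2)
          + p * (1 - p) * biasedExp W p (fun A => ‖w A‖ ^ 2) := by
      rw [← biasedExp_mul, ← biasedExp_add]
      exact biasedExp_congr fun A _ => sq_norm_two_point _ _ _
    have hb : 0 ≤ biasedExp W p (fun A => ‖w A‖ ^ 2) := by
      rw [← biasedExp_const W p 0]
      exact biasedExp_mono hp0 hp1 fun A _ => by positivity
    rw [e1, e2]
    have := mul_le_mul_of_nonneg_left hsmall
      (mul_nonneg (mul_nonneg hM hp0) hb)
    linarith

/-- The `p`-biased measure of `F(R)` on subsets of `W \ R`. -/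
noncomputable def linkMeasure (F : Finset (Finset ℕ)) (W R : Finset ℕ) (p : ℝ) : ℝ :=
  biasedExp (W \ R) p fun C => if C ∪ R ∈ F then 1 else 0

section LinkMeasure

variable {F : Finset (Finset ℕ)} {W : Finset ℕ} {p : ℝ}

theorem linkMeasure_nonneg (R : Finset ℕ) (hp0 : 0 ≤ p) (hp1 : p ≤ 1) :
    0 ≤ linkMeasure F W R p := by
  rw [← biasedExp_const (W \ R) p 0]
  exact biasedExp_mono hp0 hp1 fun A _ => by split_ifs <;> norm_num

theorem linkMeasure_le_one (R : Finset ℕ) (hp0 : 0 ≤ p) (hp1 : p ≤ 1) :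
    linkMeasure F W R p ≤ 1 := by
  rw [← biasedExp_const (W \ R) p 1]
  exact biasedExp_mono hp0 hp1 fun A _ => by split_ifs <;> norm_num

theorem exists_global_link {τ : ℝ} (hτ : 0 < τ) {R : Finset ℕ} (hR : R ⊆ W) :
    ∃ R' ⊆ W, R ⊆ R' ∧
      τ ^ R'.card * linkMeasure F W R p ≤ τ ^ R.card * linkMeasure F W R' p ∧
      ∀ B ⊆ W, R' ⊆ B →
        τ ^ R'.card * linkMeasure F W B p ≤ τ ^ B.card * linkMeasure F W R' p := by
  obtain ⟨R', hR', hmax⟩ := (Finset.Icc R W).exists_max_image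
    (fun S => linkMeasure F W S p / τ ^ S.card) ⟨R, Finset.mem_Icc.2 ⟨le_rfl, hR⟩⟩
  rw [Finset.mem_Icc] at hR'
  have h : ∀ S ⊆ W, R ⊆ S →
      τ ^ R'.card * linkMeasure F W S p ≤ τ ^ S.card * linkMeasure F W R' p := by
    intro S hS hRS
    have := hmax S (Finset.mem_Icc.2 ⟨hRS, hS⟩)
    rw [div_le_div_iff₀ (by positivity) (by positivity)] at this
    linarith
  exact ⟨R', hR'.2, hR'.1, h R hR (Subset.refl _), fun B hB hRB => h B hB (hR'.1.trans hRB)⟩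

theorem linkMeasure_restriction_le
    (hup : ∀ A ∈ F, ∀ B ⊆ W, A ⊆ B → B ∈ F) {R A B : Finset ℕ} (hR : R ⊆ W) (hB : B ⊆ W \ R)
    (hA : A ⊆ B) (hp0 : 0 ≤ p) (hp1 : p ≤ 1) :
    biasedExp ((W \ R) \ B) p (fun C => if (C ∪ A) ∪ R ∈ F then (1 : ℝ) else 0) ≤
      linkMeasure F W (B ∪ R) p := by
  unfold linkMeasure
  rw [show (W \ R) \ B = W \ (B ∪ R) by rw [sdiff_sdiff_left, sup_eq_union, union_comm]]
  refine biasedExp_mono hp0 hp1 fun C hC => ?_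
  by_cases h : (C ∪ A) ∪ R ∈ F
  · have hCW : C ⊆ W := hC.trans sdiff_subset
    have hBW : B ⊆ W := hB.trans sdiff_subset
    have : C ∪ (B ∪ R) ∈ F := hup _ h _ (union_subset hCW (union_subset hBW hR)) (by
      rw [← union_assoc]
      exact union_subset_union_left (union_subset_union_right hA))
    rw [if_pos h, if_pos this]
  · rw [if_neg h]
    split_ifs <;> norm_num

theorem rpow_linkMeasure_le (hup : ∀ A ∈ F, ∀ B ⊆ W, A ⊆ B → B ∈ F) {τ : ℝ} (hτ : 2 ≤ τ)
    (hp0 : 0 ≤ p) (hp : 2 ^ 6 * τ * p ≤ 1 / 2) {R : Finset ℕ} (hR : R ⊆ W)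
    (hglobal : ∀ B ⊆ W, R ⊆ B →
      τ ^ R.card * linkMeasure F W B p ≤ τ ^ B.card * linkMeasure F W R p) :
    linkMeasure F W R p ^ ((3 : ℝ) / 4) ≤ linkMeasure F W R (2 ^ 6 * τ * p) := by
  set q := 2 ^ 6 * τ * p with hq
  set ε := (2 ^ 6 * τ)⁻¹ with hε
  have hτ0 : 0 < τ := by linarith
  have hετ : ε * τ = 1 / 64 := by rw [hε]; field_simp; norm_num
  have hεq : ε * q = p := by rw [hε, hq]; field_simp
  have hε0 : 0 < ε := by positivity
  have hq0 : 0 ≤ q := by positivity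
  have hq1 : q ≤ 1 := by linarith
  have hε1 : ε ≤ 1 / 128 := by nlinarith
  have hp_half : p ≤ 1 / 2 := by nlinarith
  have hp1 : p ≤ 1 := by linarith
  have hsmall : 4 * ε + 12 * ε ^ 3 * τ ≤ 1 - ε * q := by
    have : ε ^ 3 * τ = ε ^ 2 * (1 / 64) := by rw [← hετ]; ring
    rw [hεq]; nlinarith
  set f : Finset ℕ → ℝ := fun C => if C ∪ R ∈ F then 1 else 0 with hf
  have hf_sq : ∀ C, f C ^ 2 = f C := fun C => by simp only [hf]; split_ifs <;> norm_num
  set M := linkMeasure F W R p with hM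
  set N := linkMeasure F W R q with hN
  have hM0 : 0 ≤ M := linkMeasure_nonneg R hp0 hp1
  have hM1 : M ≤ 1 := linkMeasure_le_one R hp0 hp1
  have hN0 : 0 ≤ N := linkMeasure_nonneg R hq0 hq1
  have hsecond : HasGlobalSecondMoment (W \ R) (ε * q) τ M f := by
    intro B hB A hA
    simp only [Real.norm_eq_abs, sq_abs, hf_sq, hεq]
    refine (linkMeasure_restriction_le hup hR hB hA hp0 hp1).trans ?_
    have hdisj : Disjoint B R := disjoint_sdiff_self_left.mono_left hB
    have h := hglobal (B ∪ R) (union_subset (hB.trans sdiff_subset) hR) subset_union_right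
    rw [card_union_of_disjoint hdisj, pow_add] at h
    have : 0 < τ ^ R.card := by positivity
    nlinarith
  have h4 := hsecond.fourth_moment_le hε0.le hq0 hq1 (by linarith) hsmall hτ0.le _ hM0
  have hMsum : biasedExp (W \ R) (ε * q) (fun A => ‖f A‖ ^ 2) = M := by
    simp only [Real.norm_eq_abs, sq_abs, hf_sq, hεq]
    rfl
  rw [hMsum] at h4
  set g : Finset ℕ → ℝ := fun x => biasedExp x ε f with hg
  have hgf : ∀ x ⊆ W \ R, g x * f x = g x := by
    intro x hx
    by_cases hxF : x ∪ R ∈ F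
    · simp [hf, hxF]
    · have : g x = 0 := by
        rw [← biasedExp_const x ε 0]
        refine biasedExp_congr fun C hC => if_neg fun hCF => hxF ?_
        exact hup _ hCF _ (union_subset (hx.trans sdiff_subset) hR)
          (union_subset_union_left hC)
      rw [this, zero_mul]
  have hfN : biasedExp (W \ R) q (fun x => f x ^ 2) = N := by
    simp only [hf_sq]
    rfl
  have hmean : biasedExp (W \ R) q (fun x => g x * f x) = M := by
    rw [biasedExp_congr hgf, hg, biasedExp_biasedExp, hεq]
    rfl
  have hCS₁ := sq_biasedExp_mul_le (W := W \ R) hq0 hq1 g f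
  have hCS₂ := sq_biasedExp_mul_le (W := W \ R) hq0 hq1 (fun x => g x ^ 2) f
  have hsq : biasedExp (W \ R) q (fun x => g x ^ 2 * f x) =
      biasedExp (W \ R) q (fun x => g x ^ 2) :=
    biasedExp_congr fun x hx => by rw [sq, mul_assoc, hgf x hx]
  have hfour : biasedExp (W \ R) q (fun x => (g x ^ 2) ^ 2) ≤ M * M := by
    refine le_trans (le_of_eq (biasedExp_congr fun x _ => ?_)) h4
    rw [← pow_mul, Real.norm_eq_abs, Even.pow_abs ⟨2, rfl⟩]
  rw [hmean, hfN] at hCS₁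
  rw [hsq, hfN] at hCS₂
  set Q := biasedExp (W \ R) q (fun x => g x ^ 2)
  have hMN : M ^ 2 * M ^ 2 ≤ M ^ 2 * N ^ 3 := by
    calc M ^ 2 * M ^ 2 ≤ (Q * N) * (Q * N) :=
          mul_le_mul hCS₁ hCS₁ (by positivity) ((sq_nonneg M).trans hCS₁)
      _ = Q ^ 2 * N ^ 2 := by ring
      _ ≤ (M * M * N) * N ^ 2 := by
        refine mul_le_mul_of_nonneg_right (hCS₂.trans ?_) (by positivity)
        exact mul_le_mul_of_nonneg_right hfour hN0
      _ = M ^ 2 * N ^ 3 := by ring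
  rcases hM0.eq_or_lt with h0 | hpos
  · rw [← h0, Real.zero_rpow (by norm_num)]
    exact hN0
  · have hMN' : M ^ 2 ≤ N ^ 3 := le_of_mul_le_mul_left hMN (by positivity)
    refine le_of_pow_le_pow_left₀ (n := 12) (by norm_num) hN0 ?_
    rw [← Real.rpow_natCast, ← Real.rpow_mul hM0]
    calc M ^ ((3 : ℝ) / 4 * (12 : ℕ)) = M ^ 9 := by
          rw [← Real.rpow_natCast]; norm_num
      _ ≤ M ^ 8 := pow_le_pow_of_le_one hM0 hM1 (by norm_num)
      _ = (M ^ 2) ^ 4 := by ring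
      _ ≤ (N ^ 3) ^ 4 := pow_le_pow_left₀ (by positivity) hMN' 4
      _ = N ^ 12 := by ring

theorem exists_link_upgrade (hup : ∀ A ∈ F, ∀ B ⊆ W, A ⊆ B → B ∈ F) {τ : ℝ} (hτ : 2 ≤ τ)
    (hp0 : 0 ≤ p) (m : ℕ) (hp : (2 ^ 6 * τ) ^ m * p ≤ 1 / 2) :
    ∃ R ⊆ W, τ ^ R.card * linkMeasure F W ∅ p ≤
        linkMeasure F W R ((2 ^ 6 * τ) ^ m * p) ∧
      linkMeasure F W ∅ p ^ (((3 : ℝ) / 4) ^ m) ≤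
        linkMeasure F W R ((2 ^ 6 * τ) ^ m * p) ∧
      ∀ B ⊆ W, R ⊆ B → τ ^ R.card * linkMeasure F W B ((2 ^ 6 * τ) ^ m * p) ≤
        τ ^ B.card * linkMeasure F W R ((2 ^ 6 * τ) ^ m * p) := by
  have hτ0 : 0 < τ := by linarith
  suffices h : ∃ R ⊆ W, τ ^ R.card * linkMeasure F W ∅ p ≤
        linkMeasure F W R ((2 ^ 6 * τ) ^ m * p) ∧
      linkMeasure F W ∅ p ^ (((3 : ℝ) / 4) ^ m) ≤
        linkMeasure F W R ((2 ^ 6 * τ) ^ m * p) by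
    obtain ⟨R, hR, h1, h2⟩ := h
    obtain ⟨R', hR', hRR', h3, h4⟩ :=
      exists_global_link (F := F) (p := (2 ^ 6 * τ) ^ m * p) hτ0 hR
    have hpow : 0 < τ ^ R.card := by positivity
    have hmono : τ ^ R.card ≤ τ ^ R'.card :=
      pow_le_pow_right₀ (by linarith) (card_le_card hRR')
    have hnonneg : 0 ≤ linkMeasure F W R ((2 ^ 6 * τ) ^ m * p) :=
      linkMeasure_nonneg R (by positivity) (hp.trans (by norm_num))
    refine ⟨R', hR', ?_, h2.trans ?_, h4⟩
    · refine le_of_mul_le_mul_left ?_ hpow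
      have := mul_le_mul_of_nonneg_left h1 (by positivity : 0 ≤ τ ^ R'.card)
      linarith
    · exact le_of_mul_le_mul_left ((mul_le_mul_of_nonneg_right hmono hnonneg).trans h3) hpow
  induction m with
  | zero => exact ⟨∅, empty_subset _, by simp, by simp⟩
  | succ m ih =>
    set P := (2 ^ 6 * τ) ^ m * p with hP
    have hP0 : 0 ≤ P := by positivity
    have hstep : (2 ^ 6 * τ) ^ (m + 1) * p = 2 ^ 6 * τ * P := by rw [hP]; ring
    rw [hstep] at hp ⊢
    have hPhalf : P ≤ 1 / 2 := by nlinarith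
    obtain ⟨R, hR, h1, h2⟩ := ih hPhalf
    obtain ⟨R', hR', hRR', h3, h4⟩ := exists_global_link (F := F) (p := P) hτ0 hR
    have hupg := rpow_linkMeasure_le hup hτ hP0 hp hR' h4
    have hpow : 0 < τ ^ R.card := by positivity
    have hmono : τ ^ R.card ≤ τ ^ R'.card :=
      pow_le_pow_right₀ (by linarith) (card_le_card hRR')
    have hnonneg : 0 ≤ linkMeasure F W R P := linkMeasure_nonneg R hP0 (by linarith)
    have hnonneg' : 0 ≤ linkMeasure F W R' P := linkMeasure_nonneg R' hP0 (by linarith)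
    have hle1 : linkMeasure F W R' P ≤ 1 := linkMeasure_le_one R' hP0 (by linarith)
    have h0 : 0 ≤ linkMeasure F W ∅ p := by
      refine linkMeasure_nonneg ∅ hp0 (le_trans ?_ (hPhalf.trans (by norm_num)))
      exact le_mul_of_one_le_left hp0 (one_le_pow₀ (by linarith))
    refine ⟨R', hR', ?_, ?_⟩
    · refine le_trans (le_of_mul_le_mul_left ?_ hpow)
        ((Real.self_le_rpow_of_le_one hnonneg' hle1 (by norm_num)).trans hupg)
      have := mul_le_mul_of_nonneg_left h1 (by positivity : 0 ≤ τ ^ R'.card)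
      linarith
    · rw [pow_succ, Real.rpow_mul h0]
      refine (Real.rpow_le_rpow (by positivity) (h2.trans ?_) (by norm_num)).trans hupg
      exact le_of_mul_le_mul_left ((mul_le_mul_of_nonneg_right hmono hnonneg).trans h3) hpow

end LinkMeasure

theorem muB_eq_biasedExp {V : Finset ℕ} {G : Finset (Finset ℕ)} (hG : G ⊆ V.powerset)
    (p : ℝ) : muB V.card p G = biasedExp V p fun C => if C ∈ G then 1 else 0 := by
  simp only [muB, biasedExp, smul_eq_mul, mul_ite, mul_one, mul_zero]
  rw [← Finset.sum_filter, Finset.filter_mem_eq_inter, Finset.inter_eq_right.2 hG]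

theorem famRestrict_subset_powerset {F : Finset (Finset ℕ)} {W : Finset ℕ}
    (hF : F ⊆ W.powerset) (R : Finset ℕ) : famRestrict F R ⊆ (W \ R).powerset := by
  intro C hC
  simp only [famRestrict, mem_image, mem_filter] at hC
  obtain ⟨A, ⟨hA, -⟩, rfl⟩ := hC
  exact mem_powerset.2 (sdiff_subset_sdiff (mem_powerset.1 (hF hA)) (Subset.refl R))

theorem mem_famRestrict_iff {F : Finset (Finset ℕ)} {R C : Finset ℕ} (hC : Disjoint C R) :
    C ∈ famRestrict F R ↔ C ∪ R ∈ F := by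
  simp only [famRestrict, mem_image, mem_filter]
  constructor
  · rintro ⟨A, ⟨hA, hRA⟩, rfl⟩
    rwa [sdiff_union_of_subset hRA]
  · exact fun h => ⟨C ∪ R, ⟨h, subset_union_right⟩, union_sdiff_cancel_right hC⟩

theorem famRestrict2_subset_powerset {G : Finset (Finset ℕ)} {V : Finset ℕ}
    (hG : G ⊆ V.powerset) (A B : Finset ℕ) : famRestrict2 G A B ⊆ (V \ B).powerset := by
  intro C hC
  simp only [famRestrict2, mem_image, mem_filter] at hC
  obtain ⟨S, ⟨hS, -⟩, rfl⟩ := hC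
  exact mem_powerset.2 (sdiff_subset_sdiff (mem_powerset.1 (hG hS)) (Subset.refl B))

theorem mem_of_mem_famRestrict2 {G : Finset (Finset ℕ)} {A B C : Finset ℕ}
    (hC : C ∈ famRestrict2 G A B) : C ∪ A ∈ G := by
  simp only [famRestrict2, mem_image, mem_filter] at hC
  obtain ⟨S, ⟨hS, rfl⟩, rfl⟩ := hC
  rwa [sdiff_union_inter]

theorem muB_famRestrict {F : Finset (Finset ℕ)} {W : Finset ℕ} (hF : F ⊆ W.powerset)
    (R : Finset ℕ) (p : ℝ) :
    muB (W \ R).card p (famRestrict F R) = linkMeasure F W R p := by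
  rw [muB_eq_biasedExp (famRestrict_subset_powerset hF R)]
  refine biasedExp_congr fun C hC => ?_
  simp only [mem_famRestrict_iff (disjoint_sdiff_self_left.mono_left hC : Disjoint C R)]

theorem isGlobalOn_famRestrict {F : Finset (Finset ℕ)} {W : Finset ℕ} (hF : F ⊆ W.powerset)
    (hup : ∀ A ∈ F, ∀ B ⊆ W, A ⊆ B → B ∈ F) {p τ : ℝ} (hτ : 0 < τ) (hp0 : 0 ≤ p)
    (hp1 : p ≤ 1) {R : Finset ℕ} (hR : R ⊆ W)
    (hglobal : ∀ B ⊆ W, R ⊆ B →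
      τ ^ R.card * linkMeasure F W B p ≤ τ ^ B.card * linkMeasure F W R p) :
    IsGlobalOn (W \ R) p τ (famRestrict F R) := by
  intro A B hA hB
  have hdisj : Disjoint B R := disjoint_sdiff_self_left.mono_left hB
  rw [muB_famRestrict hF, ← card_sdiff_of_subset hB,
    muB_eq_biasedExp (famRestrict2_subset_powerset (famRestrict_subset_powerset hF R) A B)]
  have hle : biasedExp ((W \ R) \ B) p
        (fun C => if C ∈ famRestrict2 (famRestrict F R) A B then (1 : ℝ) else 0) ≤
      biasedExp ((W \ R) \ B) p (fun C => if (C ∪ A) ∪ R ∈ F then (1 : ℝ) else 0) := by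
    refine biasedExp_mono hp0 hp1 fun C hC => ?_
    by_cases h : C ∈ famRestrict2 (famRestrict F R) A B
    · have hCA : Disjoint (C ∪ A) R := disjoint_sdiff_self_left.mono_left
        (union_subset (hC.trans sdiff_subset) (hA.trans hB))
      rw [if_pos h, if_pos ((mem_famRestrict_iff hCA).1 (mem_of_mem_famRestrict2 h))]
    · rw [if_neg h]
      split_ifs <;> norm_num
  refine (hle.trans (linkMeasure_restriction_le hup hR hB hA hp0 hp1)).trans ?_
  have h := hglobal (B ∪ R) (union_subset (hB.trans sdiff_subset) hR) subset_union_right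
  rw [card_union_of_disjoint hdisj, pow_add] at h
  have : 0 < τ ^ R.card := by positivity
  nlinarith

/-- Corollary 5.16 (upgrading the measure). -/
theorem upgrading_the_measure (n m z : ℕ) (hm : 0 < m) (hz : 0 < z)
    (τ p : ℝ) (hτ : 2 ≤ τ)
    (hp : p ∈ Set.Ioo (0:ℝ) ((((2:ℝ)^6 * τ)^m)⁻¹ / 2))
    (F : Finset (Finset ℕ)) (hF : F ⊆ (Finset.range n).powerset)
    (hup : ∀ A ∈ F, ∀ B ⊆ Finset.range n, A ⊆ B → B ∈ F)
    (hμ : τ ^ (-(z:ℤ)) ≤ muB n p F) :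
    ∃ R ⊆ Finset.range n, R.card ≤ 4 * z ∧
      (muB n p F) ^ (((3:ℝ)/4)^m) ≤
        muB (n - R.card) (((2:ℝ)^6 * τ)^m * p) (famRestrict F R) ∧
      IsGlobalOn (Finset.range n \ R) (((2:ℝ)^6 * τ)^m * p) τ (famRestrict F R) := by
  have hτ0 : 0 < τ := by linarith
  obtain ⟨hp0, hp1⟩ := hp
  have hscale : ((2:ℝ)^6 * τ)^m * p ≤ 1 / 2 := by
    have hpos : 0 < ((2:ℝ)^6 * τ)^m := by positivity
    have := mul_le_mul_of_nonneg_left hp1.le hpos.le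
    rwa [mul_div_assoc', mul_inv_cancel₀ hpos.ne'] at this
  have hscale0 : 0 ≤ ((2:ℝ)^6 * τ)^m * p := by positivity
  obtain ⟨R, hR, h1, h2, h3⟩ := exists_link_upgrade hup hτ hp0.le m hscale
  have hbase : muB n p F = linkMeasure F (range n) ∅ p := by
    have := muB_eq_biasedExp hF p
    rw [card_range] at this
    simpa [linkMeasure] using this
  refine ⟨R, hR, ?_, ?_, isGlobalOn_famRestrict hF hup hτ0 hscale0
    (hscale.trans (by norm_num)) hR h3⟩
  · have hle : τ ^ R.card * τ ^ (-(z:ℤ)) ≤ 1 := by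
      rw [hbase] at hμ
      exact ((mul_le_mul_of_nonneg_left hμ (by positivity)).trans h1).trans
        (linkMeasure_le_one R hscale0 (hscale.trans (by norm_num)))
    have hcard : τ ^ R.card ≤ τ ^ z := by
      rwa [zpow_neg, zpow_natCast, ← div_eq_mul_inv, div_le_one (by positivity)] at hle
    have := (pow_le_pow_iff_right₀ (by linarith : (1:ℝ) < τ)).1 hcard
    omega
  · have hcard : n - R.card = (range n \ R).card := by
      rw [card_sdiff_of_subset hR, card_range]
    rw [hbase, hcard, muB_famRestrict hF]
    exact h2
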